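/- Let ℓ ≥ −1/2 be a real number, x > 0, ω > 0 and n ∈ ℕ₀. Then ∫_0^x t^{ℓ+3/2} · P_n^{(ℓ+1/2, 0)}(1 − 2t²/x²) · J_{ℓ+1/2}(ω t) dt = (x^{ℓ+3/2}/ω) · J_{ℓ+2n+3/2}(ω x), where J_ν denotes the Bessel function of the first kind. -/

import Mathlib

open MeasureTheory Set Filter

/-- The Jacobi polynomial `P_n^{(a,b)}` for real parameters `a, b`. -/
noncomputable def jacobiP (a b : ℝ) (n : ℕ) (z : ℝ) : ℝ :=
  (Real.Gamma (a + n + 1) / (n.factorial * Real.Gamma (a + b + n + 1))) *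
    ∑ k ∈ Finset.range (n + 1),
      (n.choose k : ℝ) * (Real.Gamma (a + b + n + k + 1) / Real.Gamma (a + k + 1)) *
        ((z - 1) / 2) ^ k

/-- The Bessel function of the first kind,
`J_ν(z) = ∑_{k=0}^∞ ((-1)^k/(k! Γ(k+ν+1))) (z/2)^{2k+ν}`. -/
noncomputable def besselJ (ν : ℝ) (z : ℝ) : ℝ :=
  ∑' k : ℕ, ((-1 : ℝ) ^ k / (k.factorial * Real.Gamma ((k : ℝ) + ν + 1))) *
    (z / 2) ^ (2 * (k : ℝ) + ν)

theorem fwdDiff_iter_eq_neg_one_pow_mul_sum (f : ℝ → ℝ) (n : ℕ) (y : ℝ) :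
    (fwdDiff 1)^[n] f y =
      (-1) ^ n * ∑ k ∈ Finset.range (n + 1), (-1) ^ k * (n.choose k : ℝ) * f (y + k) := by
  rw [fwdDiff_iter_eq_sum_shift, Finset.mul_sum]
  refine Finset.sum_congr rfl fun k hk => ?_
  have hkn : k ≤ n := Nat.lt_succ_iff.mp (Finset.mem_range.mp hk)
  have hsign : (-1 : ℝ) ^ (n - k) = (-1) ^ n * (-1) ^ k := by
    obtain ⟨d, rfl⟩ := Nat.exists_eq_add_of_le hkn
    rw [Nat.add_sub_cancel_left, pow_add, mul_right_comm, ← mul_pow]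
    simp
  simp only [zsmul_eq_mul, nsmul_eq_mul, mul_one]
  push_cast
  rw [hsign]
  ring

theorem fwdDiff_iter_inv (n : ℕ) {y : ℝ} (hy : 0 < y) :
    (fwdDiff 1)^[n] (fun z : ℝ => z⁻¹) y =
      (-1) ^ n * n.factorial / ∏ j ∈ Finset.range (n + 1), (y + j) := by
  induction n generalizing y with
  | zero => simp
  | succ n ih =>
    rw [Function.iterate_succ_apply', fwdDiff, ih hy, ih (by positivity : 0 < y + 1)]
    have hpos (z : ℝ) (hz : 0 < z) (k : ℕ) : ∏ j ∈ Finset.range k, (z + j) ≠ 0 :=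
      (Finset.prod_pos fun j _ => by positivity).ne'
    have hshift : ∏ j ∈ Finset.range (n + 1 + 1), (y + j) =
        y * ∏ j ∈ Finset.range (n + 1), (y + 1 + j) := by
      rw [Finset.prod_range_succ', mul_comm]
      congr 1
      · simp
      · exact Finset.prod_congr rfl fun j _ => by push_cast; ring
    have hlast : ∏ j ∈ Finset.range (n + 1 + 1), (y + j) =
        (∏ j ∈ Finset.range (n + 1), (y + j)) * (y + (n + 1)) := by
      rw [Finset.prod_range_succ]; push_cast; rfl
    have hB : ∏ j ∈ Finset.range (n + 1), (y + 1 + (j : ℝ)) =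
        (∏ j ∈ Finset.range (n + 1), (y + j)) * (y + (n + 1)) / y := by
      rw [eq_div_iff hy.ne', ← hlast, hshift, mul_comm]
    have h1 := hpos y hy (n + 1)
    have h2 : y + ((n : ℝ) + 1) ≠ 0 := by positivity
    rw [hlast, hB, Nat.factorial_succ]
    push_cast
    field_simp
    ring

theorem sum_neg_one_pow_choose_mul_eval_div (p : Polynomial ℝ) {n : ℕ} (hp : p.natDegree ≤ n)
    {y : ℝ} (hy : 0 < y) :
    ∑ k ∈ Finset.range (n + 1), (-1) ^ k * (n.choose k : ℝ) * (p.eval (k : ℝ) / (y + k)) =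
      n.factorial * p.eval (-y) / ∏ j ∈ Finset.range (n + 1), (y + j) := by
  have hinv := fwdDiff_iter_inv n hy
  rw [fwdDiff_iter_eq_neg_one_pow_mul_sum, mul_div_assoc] at hinv
  replace hinv := mul_left_cancel₀ (pow_ne_zero n (by norm_num : (-1 : ℝ) ≠ 0)) hinv
  obtain ⟨q, hq⟩ := Polynomial.X_sub_C_dvd_sub_C_eval (p := p) (a := -y)
  have heval (k : ℕ) : p.eval (k : ℝ) / (y + k) = q.eval (k : ℝ) + p.eval (-y) * (y + k)⁻¹ := by
    have h := congrArg (Polynomial.eval (k : ℝ)) hq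
    simp only [Polynomial.eval_sub, Polynomial.eval_C, Polynomial.eval_mul,
      Polynomial.eval_X] at h
    have : y + k ≠ 0 := by positivity
    field_simp
    linarith
  have hzero : ∑ k ∈ Finset.range (n + 1), (-1) ^ k * (n.choose k : ℝ) * q.eval (k : ℝ) = 0 := by
    rcases eq_or_ne q 0 with rfl | hq0
    · simp
    have hdeg : q.natDegree < n := by
      have h := congrArg Polynomial.natDegree hq
      rw [Polynomial.natDegree_sub_C, Polynomial.natDegree_mul (Polynomial.X_sub_C_ne_zero _) hq0,
        Polynomial.natDegree_X_sub_C] at h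
      omega
    have h := congrFun (Polynomial.fwdDiff_iter_eq_zero_of_degree_lt hdeg) 0
    rw [fwdDiff_iter_eq_neg_one_pow_mul_sum] at h
    simpa using h
  simp_rw [heval, mul_add, Finset.sum_add_distrib, hzero, zero_add]
  rw [mul_div_right_comm, ← hinv, Finset.sum_mul]
  exact Finset.sum_congr rfl fun k _ => by ring

theorem Real.Gamma_add_natCast_eq_mul_prod {s : ℝ} (hs : 0 < s) (n : ℕ) :
    Real.Gamma (s + n) = Real.Gamma s * ∏ j ∈ Finset.range n, (s + j) := by
  induction n with
  | zero => simp
  | succ n ih =>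
    rw [Nat.cast_succ, ← add_assoc, Real.Gamma_add_one (by positivity), ih,
      Finset.prod_range_succ]
    ring

theorem prod_range_natCast_sub_eq_descFactorial (m n : ℕ) :
    ∏ j ∈ Finset.range n, ((j : ℝ) - m) = (-1) ^ n * m.descFactorial n := by
  induction n with
  | zero => simp
  | succ n ih =>
    rw [Finset.prod_range_succ, ih, Nat.descFactorial_succ]
    rcases le_or_gt n m with h | h
    · push_cast [h]
      ring
    · simp [Nat.descFactorial_eq_zero_iff_lt.mpr h]

theorem sum_choose_mul_Gamma_div {a : ℝ} (ha : 0 ≤ a) (n m : ℕ) :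
    ∑ k ∈ Finset.range (n + 1), (-1) ^ k * (n.choose k : ℝ) *
        (Real.Gamma (a + n + k + 1) / Real.Gamma (a + k + 1) / (m + a + 1 + k)) =
      n.factorial * ((-1) ^ n * m.descFactorial n) *
        (Real.Gamma (m + a + 1) / Real.Gamma (m + a + n + 2)) := by
  let p : Polynomial ℝ := ∏ j ∈ Finset.range n, (Polynomial.X + Polynomial.C (a + 1 + j))
  have hp : p.natDegree ≤ n := by
    refine (Polynomial.natDegree_prod_le _ _).trans ?_
    simp only [Polynomial.natDegree_X_add_C]
    simp
  have hpe (z : ℝ) : p.eval z = ∏ j ∈ Finset.range n, (z + (a + 1 + j)) := by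
    simp [p, Polynomial.eval_prod]
  have h := sum_neg_one_pow_choose_mul_eval_div p hp (y := m + a + 1) (by positivity)
  have hG (k : ℕ) : Real.Gamma (a + n + k + 1) / Real.Gamma (a + k + 1) = p.eval (k : ℝ) := by
    have hs : 0 < a + k + 1 := by positivity
    rw [hpe, div_eq_iff (Real.Gamma_pos_of_pos hs).ne',
      show a + n + k + 1 = a + k + 1 + n by ring, Real.Gamma_add_natCast_eq_mul_prod hs, mul_comm]
    congr 1
    exact Finset.prod_congr rfl fun j _ => by ring
  have hneg : p.eval (-((m : ℝ) + a + 1)) = (-1) ^ n * m.descFactorial n := by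
    rw [hpe, ← prod_range_natCast_sub_eq_descFactorial]
    exact Finset.prod_congr rfl fun j _ => by ring
  have hs : 0 < (m : ℝ) + a + 1 := by positivity
  simp_rw [hG]
  rw [h, hneg, show (m : ℝ) + a + n + 2 = m + a + 1 + (n + 1 : ℕ) by push_cast; ring,
    Real.Gamma_add_natCast_eq_mul_prod hs]
  have := (Real.Gamma_pos_of_pos hs).ne'
  field_simp

theorem continuous_jacobiP (a b : ℝ) (n : ℕ) : Continuous (jacobiP a b n) := by
  unfold jacobiP
  fun_prop

theorem Gamma_add_one_le_Gamma_natCast_add {a : ℝ} (ha : 0 ≤ a) (m : ℕ) :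
    Real.Gamma (a + 1) ≤ Real.Gamma (m + a + 1) := by
  induction m with
  | zero => simp
  | succ m ih =>
    have hs : 0 < (m : ℝ) + a + 1 := by positivity
    rw [show ((m + 1 : ℕ) : ℝ) + a + 1 = m + a + 1 + 1 by push_cast; ring,
      Real.Gamma_add_one hs.ne']
    have := Real.Gamma_pos_of_pos hs
    have : (0 : ℝ) ≤ m + a := by positivity
    nlinarith

theorem summable_norm_besselJ_terms {a : ℝ} (ha : 0 ≤ a) {z : ℝ} (hz : 0 < z) :
    Summable fun m : ℕ => ‖(-1 : ℝ) ^ m / (m.factorial * Real.Gamma ((m : ℝ) + a + 1))‖ *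
      z ^ (2 * (m : ℝ) + a) := by
  have hG := Real.Gamma_pos_of_pos (by positivity : 0 < a + 1)
  refine Summable.of_nonneg_of_le (fun m => by positivity) (fun m => ?_)
    ((Real.summable_pow_div_factorial (z ^ 2)).mul_left (z ^ a / Real.Gamma (a + 1)))
  have hle := Gamma_add_one_le_Gamma_natCast_add ha m
  have hGm := hG.trans_le hle
  rw [norm_div, norm_pow, norm_neg, norm_one, one_pow, Real.norm_of_nonneg (by positivity),
    Real.rpow_add hz, show (2 * (m : ℝ)) = ((2 * m : ℕ) : ℝ) by push_cast; ring,
    Real.rpow_natCast, pow_mul, one_div_mul_eq_div, div_mul_div_comm, mul_comm (z ^ a),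
    mul_comm (Real.Gamma (a + 1))]
  gcongr

/-- Termwise integration against the Bessel series of nonnegative order. -/
theorem hasSum_integral_mul_besselJ {a x ω : ℝ} (ha : 0 ≤ a) (hx : 0 < x) (hω : 0 < ω)
    {g : ℝ → ℝ} (hg : Continuous g) :
    HasSum (fun m : ℕ => ∫ t in (0)..x, g t *
        ((-1 : ℝ) ^ m / (m.factorial * Real.Gamma ((m : ℝ) + a + 1)) *
          (ω * t / 2) ^ (2 * (m : ℝ) + a)))
      (∫ t in (0)..x, g t * besselJ a (ω * t)) := by
  let f (m : ℕ) : C(ℝ, ℝ) := ⟨fun t => g t *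
    ((-1 : ℝ) ^ m / (m.factorial * Real.Gamma ((m : ℝ) + a + 1)) *
      (ω * t / 2) ^ (2 * (m : ℝ) + a)), by
    have : Continuous fun t : ℝ => (ω * t / 2) ^ (2 * (m : ℝ) + a) :=
      Continuous.rpow_const (by fun_prop) fun t => Or.inr (by positivity)
    fun_prop⟩
  obtain ⟨M, hM⟩ := (isCompact_Icc (a := (0 : ℝ)) (b := x)).exists_bound_of_continuousOn
    hg.continuousOn
  have hM0 : 0 ≤ M := (norm_nonneg _).trans (hM 0 ⟨le_rfl, hx.le⟩)
  have hsum : Summable fun m : ℕ =>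
      ‖(f m).restrict (⟨uIcc 0 x, isCompact_uIcc⟩ : TopologicalSpace.Compacts ℝ)‖ := by
    refine Summable.of_nonneg_of_le (fun m => norm_nonneg _) (fun m => ?_)
      ((summable_norm_besselJ_terms ha (by positivity : 0 < ω * x / 2)).mul_left M)
    rw [ContinuousMap.norm_le _ (by positivity)]
    rintro ⟨t, ht⟩
    have ht_mem : t ∈ Icc 0 x := by simpa [uIcc_of_le hx.le] using ht
    have ht0 := ht_mem.1
    change ‖g t * (_ * _)‖ ≤ _
    rw [norm_mul, norm_mul,
      Real.norm_of_nonneg (by positivity : 0 ≤ (ω * t / 2) ^ (2 * (m : ℝ) + a))]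
    gcongr
    · exact hM t ht_mem
    · exact ht_mem.2
  have h := intervalIntegral.hasSum_intervalIntegral_of_summable_norm hsum
  simp only [f, ContinuousMap.coe_mk, tsum_mul_left] at h
  exact h

theorem integral_rpow_mul_jacobiP_mul_rpow {a x ω : ℝ} (ha : 0 ≤ a) (hx : 0 < x) (hω : 0 < ω)
    (n m : ℕ) :
    ∫ t in (0)..x, t ^ (a + 1) * jacobiP a 0 n (1 - 2 * t ^ 2 / x ^ 2) *
        (ω * t / 2) ^ (2 * (m : ℝ) + a) =
      (ω / 2) ^ (2 * (m : ℝ) + a) * (x ^ (2 * (m : ℝ) + 2 * a + 2) / 2) *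
        ((-1) ^ n * m.descFactorial n *
          (Real.Gamma (m + a + 1) / Real.Gamma (m + a + n + 2))) := by
  have hGn := (Real.Gamma_pos_of_pos (by positivity : 0 < a + n + 1)).ne'
  have hpt : ∀ t ∈ Ioo 0 x, t ^ (a + 1) * jacobiP a 0 n (1 - 2 * t ^ 2 / x ^ 2) *
        (ω * t / 2) ^ (2 * (m : ℝ) + a) =
      ∑ k ∈ Finset.range (n + 1), (ω / 2) ^ (2 * (m : ℝ) + a) / n.factorial * ((-1) ^ k *
        (n.choose k : ℝ) * (Real.Gamma (a + n + k + 1) / Real.Gamma (a + k + 1))) /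
        x ^ (2 * k) * t ^ (2 * (m : ℝ) + 2 * a + 1 + 2 * k) := by
    intro t ht
    have ht0 := ht.1
    rw [jacobiP, add_zero, div_mul_cancel_right₀ hGn, mul_div_right_comm ω t 2,
      Real.mul_rpow (by positivity) ht0.le, Finset.mul_sum, Finset.mul_sum, Finset.sum_mul]
    refine Finset.sum_congr rfl fun k _ => ?_
    have hpow : t ^ (2 * (m : ℝ) + 2 * a + 1 + 2 * k) =
        t ^ (a + 1) * t ^ (2 * (m : ℝ) + a) * t ^ (2 * k) := by
      rw [← Real.rpow_natCast t (2 * k), ← Real.rpow_add ht0, ← Real.rpow_add ht0]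
      congr 1
      push_cast
      ring
    rw [hpow, show (1 - 2 * t ^ 2 / x ^ 2 - 1) / 2 = -1 * (t ^ 2 / x ^ 2) by ring, mul_pow,
      div_pow, ← pow_mul, ← pow_mul]
    ring
  have hexp (k : ℕ) : (0 : ℝ) ≤ 2 * (m : ℝ) + 2 * a + 1 + 2 * k := by positivity
  rw [intervalIntegral.integral_of_le hx.le, integral_Ioc_eq_integral_Ioo,
    setIntegral_congr_fun measurableSet_Ioo hpt, ← integral_Ioc_eq_integral_Ioo,
    ← intervalIntegral.integral_of_le hx.le, intervalIntegral.integral_finsetSum]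
  swap
  · intro k _
    exact (intervalIntegral.intervalIntegrable_rpow (Or.inl (hexp k))).const_mul _
  have hterm (k : ℕ) : ∫ t in (0)..x, (ω / 2) ^ (2 * (m : ℝ) + a) / n.factorial * ((-1) ^ k *
        (n.choose k : ℝ) * (Real.Gamma (a + n + k + 1) / Real.Gamma (a + k + 1))) /
        x ^ (2 * k) * t ^ (2 * (m : ℝ) + 2 * a + 1 + 2 * k) =
      (ω / 2) ^ (2 * (m : ℝ) + a) / n.factorial * (x ^ (2 * (m : ℝ) + 2 * a + 2) / 2) *
        ((-1) ^ k * (n.choose k : ℝ) *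
        (Real.Gamma (a + n + k + 1) / Real.Gamma (a + k + 1) / (m + a + 1 + k))) := by
    have := hexp k
    rw [intervalIntegral.integral_const_mul, integral_rpow (Or.inl (by linarith)),
      Real.zero_rpow (by positivity),
      show 2 * (m : ℝ) + 2 * a + 1 + 2 * k + 1 = 2 * (m : ℝ) + 2 * a + 2 + (2 * k : ℕ) by
        push_cast; ring, Real.rpow_add hx, Real.rpow_natCast]
    have h1 : (m : ℝ) + a + 1 + k ≠ 0 := by positivity
    have h2 : 2 * (m : ℝ) + 2 * a + 2 + (2 * k : ℕ) = 2 * (m + a + 1 + k) := by push_cast; ring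
    rw [h2]
    field_simp
    ring
  simp_rw [hterm]
  rw [← Finset.mul_sum, sum_choose_mul_Gamma_div ha]
  have : (n.factorial : ℝ) ≠ 0 := by positivity
  field_simp

/-- `∫_0^x t^{ℓ+3/2} P_n^{(ℓ+1/2,0)}(1-2t²/x²) J_{ℓ+1/2}(ωt) dt = (x^{ℓ+3/2}/ω) J_{ℓ+2n+3/2}(ωx)`. -/
theorem jacobi_bessel_integral
    (l x ω : ℝ) (hl : -(1/2 : ℝ) ≤ l) (hx : 0 < x) (hω : 0 < ω) (n : ℕ) :
    (∫ t in Set.Ioo 0 x,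
      t ^ (l + 3 / 2) * jacobiP (l + 1 / 2) 0 n (1 - 2 * t ^ 2 / x ^ 2) *
        besselJ (l + 1 / 2) (ω * t)) =
      x ^ (l + 3 / 2) / ω * besselJ (l + 2 * n + 3 / 2) (ω * x) := by
  obtain ⟨a, rfl⟩ : ∃ a, l = a - 1 / 2 := ⟨l + 1 / 2, by ring⟩
  have ha : 0 ≤ a := by linarith
  rw [show a - 1 / 2 + 3 / 2 = a + 1 by ring, show a - 1 / 2 + 1 / 2 = a by ring,
    show a - 1 / 2 + 2 * n + 3 / 2 = a + 2 * n + 1 by ring,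
    ← integral_Ioc_eq_integral_Ioo, ← intervalIntegral.integral_of_le hx.le]
  have hg : Continuous fun t : ℝ =>
      t ^ (a + 1) * jacobiP a 0 n (1 - 2 * t ^ 2 / x ^ 2) := by
    have h1 : Continuous fun t : ℝ => t ^ (a + 1) :=
      Continuous.rpow_const continuous_id fun t => Or.inr (by positivity)
    exact h1.mul ((continuous_jacobiP a 0 n).comp (by fun_prop))
  have hterm (m : ℕ) : ∫ t in (0)..x, t ^ (a + 1) * jacobiP a 0 n (1 - 2 * t ^ 2 / x ^ 2) *
        ((-1 : ℝ) ^ m / (m.factorial * Real.Gamma ((m : ℝ) + a + 1)) *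
          (ω * t / 2) ^ (2 * (m : ℝ) + a)) =
      (-1 : ℝ) ^ m / (m.factorial * Real.Gamma ((m : ℝ) + a + 1)) *
      ((ω / 2) ^ (2 * (m : ℝ) + a) * (x ^ (2 * (m : ℝ) + 2 * a + 2) / 2) *
        ((-1) ^ n * m.descFactorial n *
          (Real.Gamma (m + a + 1) / Real.Gamma (m + a + n + 2)))) := by
    rw [← integral_rpow_mul_jacobiP_mul_rpow ha hx hω, ← intervalIntegral.integral_const_mul]
    congr 1
    ext t
    ring
  rw [← (hasSum_integral_mul_besselJ ha hx hω hg).tsum_eq, besselJ, ← tsum_mul_left]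
  simp_rw [hterm]
  rw [← Function.Injective.tsum_eq (add_left_injective n)]
  · refine tsum_congr fun p => ?_
    have hG1 := (Real.Gamma_pos_of_pos (by positivity : 0 < ((p + n : ℕ) : ℝ) + a + 1)).ne'
    have hG2 := (Real.Gamma_pos_of_pos (by positivity : 0 < (p : ℝ) + (a + 2 * n + 1) + 1)).ne'
    have hfac : ((p + n).factorial : ℝ) = p.factorial * (p + n).descFactorial n := by
      rw [← Nat.factorial_mul_descFactorial (Nat.le_add_left n p), Nat.add_sub_cancel]
      push_cast
      rfl
    have hd : ((p + n).descFactorial n : ℝ) ≠ 0 :=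
      Nat.cast_ne_zero.mpr (Nat.descFactorial_eq_zero_iff_lt.not.mpr (by omega))
    have hsign : (-1 : ℝ) ^ (p + n) * (-1) ^ n = (-1) ^ p := by
      rw [pow_add, mul_assoc, ← mul_pow]
      simp
    have hx_pow : x ^ (2 * ((p + n : ℕ) : ℝ) + 2 * a + 2) =
        x ^ (a + 1) * x ^ (2 * (p : ℝ) + (a + 2 * n + 1)) := by
      rw [← Real.rpow_add hx]
      congr 1
      push_cast
      ring
    have hω_pow : (ω / 2) ^ (2 * (p : ℝ) + (a + 2 * n + 1)) =
        (ω / 2) ^ (2 * ((p + n : ℕ) : ℝ) + a) * (ω / 2) := by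
      rw [← Real.rpow_add_one (by positivity)]
      congr 1
      push_cast
      ring
    rw [mul_div_right_comm ω x 2, Real.mul_rpow (by positivity) hx.le, hω_pow, hx_pow, hfac, ← hsign,
      show ((p + n : ℕ) : ℝ) + a + n + 2 = p + (a + 2 * n + 1) + 1 by push_cast; ring]
    field_simp
  · intro m hm
    rw [Function.mem_support] at hm
    have hnm : n ≤ m := by
      by_contra! h
      exact hm (by simp [Nat.descFactorial_eq_zero_iff_lt.mpr h])
    exact ⟨m - n, Nat.sub_add_cancel hnm⟩
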